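/- For every nonnegative integer n, a̅₅(20n+6) ≡ 0 (mod 10) and a̅₅(20n+14) ≡ 0 (mod 10). -/

import Mathlib

open scoped BigOperators

/-- The q-Pochhammer infinite product `(a; q)_∞ = ∏_{k≥0} (1 - a q^k)`. -/
noncomputable def qpoch (a q : ℂ) : ℂ := ∏' k : ℕ, (1 - a * q ^ k)

/-- `φ(-q) = (q;q)_∞² / (q²;q²)_∞`. -/
noncomputable def phiNeg (q : ℂ) : ℂ := qpoch q q ^ 2 / qpoch (q ^ 2) (q ^ 2)

/-- `ψ(-q) = (q;q)_∞ (q⁴;q⁴)_∞ / (q²;q²)_∞`. -/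
noncomputable def psiNeg (q : ℂ) : ℂ :=
  qpoch q q * qpoch (q ^ 4) (q ^ 4) / qpoch (q ^ 2) (q ^ 2)

open PowerSeries

/-- number of integers `m` satisfying `P` with `m² = n` -/
noncomputable def cnt (P : ℤ → Prop) [DecidablePred P] (n : ℕ) : ℕ :=
  ((Finset.Icc (-(n:ℤ)) n).filter (fun m => P m ∧ m ^ 2 = (n : ℤ))).card

/-- number of pairs with `a² + b² = n` -/
noncomputable def cnt2 (P : ℤ → ℤ → Prop) [∀ a b, Decidable (P a b)] (n : ℕ) : ℕ :=
  ((Finset.Icc (-(n:ℤ)) n ×ˢ Finset.Icc (-(n:ℤ)) n).filter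
    (fun m => P m.1 m.2 ∧ m.1 ^ 2 + m.2 ^ 2 = (n : ℤ))).card

noncomputable def Th (R : Type*) [CommRing R] (P : ℤ → Prop) [DecidablePred P] : PowerSeries R :=
  PowerSeries.mk fun n => (cnt P n : R)

lemma mem_box {a : ℤ} {n : ℕ} (h : a ^ 2 ≤ n) : -(n:ℤ) ≤ a ∧ a ≤ n := by
  constructor <;> nlinarith [sq_nonneg (a-1), sq_nonneg (a+1), sq_nonneg a]

lemma mem_box' {a b: ℤ} {n : ℕ} (h : a ^ 2 + b ^ 2 = n) :
    (-(n:ℤ) ≤ a ∧ a ≤ n) ∧ (-(n:ℤ) ≤ b ∧ b ≤ n) :=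
  ⟨mem_box (by nlinarith [sq_nonneg b]), mem_box (by nlinarith [sq_nonneg a])⟩

lemma Th_mul (R : Type*) [CommRing R] (P Q : ℤ → Prop) [DecidablePred P] [DecidablePred Q] (n : ℕ) :
    coeff n (Th R P * Th R Q) = (cnt2 (fun a b => P a ∧ Q b) n : R) := by
  rw [coeff_mul]
  simp only [Th, coeff_mk]
  rw [cnt2, Finset.card_eq_sum_card_fiberwise (t := Finset.HasAntidiagonal.antidiagonal n)
    (f := fun m : ℤ × ℤ => ((m.1 ^ 2).toNat, (m.2 ^ 2).toNat))]
  · push_cast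
    refine Finset.sum_congr rfl ?_
    rintro ⟨i, j⟩ hij
    rw [Finset.HasAntidiagonal.mem_antidiagonal] at hij
    simp only at hij
    rw [← Nat.cast_mul, cnt, cnt, ← Finset.card_product]
    congr 2
    ext ⟨a, b⟩
    simp only [Finset.mem_product, Finset.mem_filter, Finset.mem_Icc, Prod.mk.injEq]
    constructor
    · rintro ⟨⟨_, ha, ha2⟩, ⟨_, hb, hb2⟩⟩
      have : a ^ 2 + b ^ 2 = n := by rw [ha2, hb2]; exact_mod_cast hij
      refine ⟨⟨mem_box' this, ⟨ha, hb⟩, this⟩, ?_, ?_⟩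
      · rw [ha2]; simp
      · rw [hb2]; simp
    · rintro ⟨⟨_, ⟨ha, hb⟩, h⟩, h1, h2⟩
      have h1' : a ^ 2 = i := by rw [← h1, Int.toNat_of_nonneg (sq_nonneg a)]
      have h2' : b ^ 2 = j := by rw [← h2, Int.toNat_of_nonneg (sq_nonneg b)]
      exact ⟨⟨mem_box h1'.le, ha, h1'⟩, mem_box h2'.le, hb, h2'⟩
  · rintro ⟨a, b⟩ h
    simp only [Finset.coe_filter, Set.mem_ofPred_eq] at h
    simp only [Finset.mem_coe, Finset.HasAntidiagonal.mem_antidiagonal]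
    have := h.2.2
    have h1 := sq_nonneg a
    have h2 := sq_nonneg b
    omega

lemma cnt2_odd (P : ℤ → ℤ → Prop) [∀ a b, Decidable (P a b)] (h : ∀ a b, P a b → (a + b) % 2 = 0)
    (n : ℕ) (hn : n % 2 = 1) : cnt2 P n = 0 := by
  rw [cnt2, Finset.card_eq_zero, Finset.filter_eq_empty_iff]
  rintro ⟨a, b⟩ _ ⟨h1, h2⟩
  have := h a b h1
  simp only at h2
  obtain ⟨k, hk⟩ : ∃ k, a = 2 * k - b := ⟨(a + b) / 2, by omega⟩
  have : (n : ℤ) = 2 * (2 * k ^ 2 - 2 * k * b + b ^ 2) := by rw [← h2, hk]; ring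
  omega

lemma cnt2_rot (P Q : ℤ → ℤ → Prop) [∀ a b, Decidable (P a b)] [∀ a b, Decidable (Q a b)]
    (h : ∀ a b, P a b → (a + b) % 2 = 0) (hPQ : ∀ a b, Q a b ↔ P (a + b) (a - b))
    (n : ℕ) : cnt2 P (2 * n) = cnt2 Q n := by
  rw [cnt2, cnt2]
  symm
  refine Finset.card_bij' (fun m _ => (m.1 + m.2, m.1 - m.2))
    (fun m _ => ((m.1 + m.2) / 2, (m.1 - m.2) / 2)) ?_ ?_ ?_ ?_
  · rintro ⟨a, b⟩ hab
    simp only [Finset.mem_filter, Finset.mem_product, Finset.mem_Icc] at hab ⊢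
    have h3 : (a + b) ^ 2 + (a - b) ^ 2 = ((2 * n : ℕ) : ℤ) := by
      push_cast; rw [← hab.2.2]; ring
    exact ⟨mem_box' h3, (hPQ a b).1 hab.2.1, h3⟩
  · rintro ⟨a, b⟩ hab
    simp only [Finset.mem_filter, Finset.mem_product, Finset.mem_Icc] at hab ⊢
    have h1 := h a b hab.2.1
    obtain ⟨k, hk⟩ : ∃ k, a = 2 * k - b := ⟨(a + b) / 2, by omega⟩
    have e1 : (a + b) / 2 = k := by omega
    have e2 : (a - b) / 2 = k - b := by omega
    rw [e1, e2]
    have h3 : k ^ 2 + (k - b) ^ 2 = (n : ℤ) := by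
      have := hab.2.2
      push_cast at this
      rw [hk] at this
      linarith
    refine ⟨mem_box' h3, (hPQ _ _).2 ?_, h3⟩
    have : k + (k - b) = a := by omega
    rw [this]
    convert hab.2.1 using 1
    ring
  · rintro ⟨a, b⟩ _
    simp only [Prod.mk.injEq]
    omega
  · rintro ⟨a, b⟩ hab
    simp only [Finset.mem_filter, Finset.mem_product, Finset.mem_Icc] at hab
    have h1 := h a b hab.2.1
    simp only [Prod.mk.injEq]
    omega

lemma cnt2_or (P Q S : ℤ → ℤ → Prop) [∀ a b, Decidable (P a b)] [∀ a b, Decidable (Q a b)]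
    [∀ a b, Decidable (S a b)] (hS : ∀ a b, S a b ↔ P a b ∨ Q a b)
    (hd : ∀ a b, P a b → ¬ Q a b) (n : ℕ) : cnt2 S n = cnt2 P n + cnt2 Q n := by
  rw [cnt2, cnt2, cnt2, ← Finset.card_union_of_disjoint]
  · congr 1
    ext ⟨a, b⟩
    simp only [Finset.mem_filter, Finset.mem_union, hS]
    tauto
  · rw [Finset.disjoint_filter]
    rintro ⟨a, b⟩ _ h1 h2
    exact hd a b h1.1 h2.1

noncomputable abbrev pp (R : Type*) [CommRing R] : PowerSeries R := Th R (fun m => m % 2 = 0)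
noncomputable abbrev tt (R : Type*) [CommRing R] : PowerSeries R := Th R (fun m => m % 2 = 1)

lemma landen1 (R : Type*) [CommRing R] :
    pp R ^ 2 = expand 2 two_ne_zero (pp R) ^ 2 + expand 2 two_ne_zero (tt R) ^ 2 := by
  rw [← map_pow, ← map_pow, ← map_add, sq, sq]
  ext n
  rw [coeff_expand, Th_mul]
  split_ifs with h
  · obtain ⟨m, rfl⟩ := h
    rw [Nat.mul_div_cancel_left _ (by norm_num), map_add, Th_mul, Th_mul, ← Nat.cast_add]
    rw [cnt2_rot _ (fun a b => (a + b) % 2 = 0) (by intro a b; omega) (by intro a b; omega)]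
    rw [cnt2_or (fun a b => a % 2 = 0 ∧ b % 2 = 0) (fun a b => a % 2 = 1 ∧ b % 2 = 1) _
      (by intro a b; omega) (by intro a b; omega)]
  · rw [cnt2_odd _ (by intro a b; omega) n (by omega)]; simp

lemma landen2 (R : Type*) [CommRing R] :
    tt R ^ 2 = 2 * expand 2 two_ne_zero (pp R) * expand 2 two_ne_zero (tt R) := by
  have : (2 * expand 2 two_ne_zero (pp R) * expand 2 two_ne_zero (tt R)) =
    expand 2 two_ne_zero (pp R * tt R + tt R * pp R) := by
    rw [map_add, map_mul, map_mul]; ring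
  rw [this, sq]
  ext n
  rw [coeff_expand, Th_mul]
  split_ifs with h
  · obtain ⟨m, rfl⟩ := h
    rw [Nat.mul_div_cancel_left _ (by norm_num), map_add, Th_mul, Th_mul, ← Nat.cast_add]
    rw [cnt2_rot _ (fun a b => (a + b) % 2 = 1) (by intro a b; omega) (by intro a b; omega)]
    rw [cnt2_or (fun a b => a % 2 = 0 ∧ b % 2 = 1) (fun a b => a % 2 = 1 ∧ b % 2 = 0) _
      (by intro a b; omega) (by intro a b; omega)]
  · rw [cnt2_odd _ (by intro a b; omega) n (by omega)]; simp

lemma cnt_supp0 (n : ℕ) (h : n % 4 ≠ 0) : cnt (fun m => m % 2 = 0) n = 0 := by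
  rw [cnt, Finset.card_eq_zero, Finset.filter_eq_empty_iff]
  rintro a _ ⟨h1, h2⟩
  obtain ⟨k, rfl⟩ : ∃ k, a = 2 * k := ⟨a / 2, by omega⟩
  have : (n : ℤ) = 4 * k ^ 2 := by rw [← h2]; ring
  omega

lemma cnt_supp1 (n : ℕ) (h : n % 4 ≠ 1) : cnt (fun m => m % 2 = 1) n = 0 := by
  rw [cnt, Finset.card_eq_zero, Finset.filter_eq_empty_iff]
  rintro a _ ⟨h1, h2⟩
  obtain ⟨k, rfl⟩ : ∃ k, a = 2 * k + 1 := ⟨a / 2, by omega⟩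
  have : (n : ℤ) = 4 * (k ^ 2 + k) + 1 := by rw [← h2]; ring
  omega

/-- Graded pieces mod 4 -/
def Gr {R : Type*} [CommRing R] (i : ZMod 4) (f : PowerSeries R) : Prop :=
  ∀ n : ℕ, (n : ZMod 4) ≠ i → coeff n f = 0

lemma Gr.mul {R : Type*} [CommRing R] {i j : ZMod 4} {f g : PowerSeries R} (hf : Gr i f)
    (hg : Gr j g) : Gr (i + j) (f * g) := by
  intro n hn
  rw [coeff_mul]
  refine Finset.sum_eq_zero ?_
  rintro ⟨a, b⟩ hab
  rw [Finset.HasAntidiagonal.mem_antidiagonal] at hab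
  by_cases h1 : (a : ZMod 4) = i
  · by_cases h2 : (b : ZMod 4) = j
    · exact absurd (by rw [← hab, Nat.cast_add, h1, h2]) hn
    · simp [hg b h2]
  · simp [hf a h1]

lemma Gr.one {R : Type*} [CommRing R] : Gr 0 (1 : PowerSeries R) := by
  intro n hn
  rw [coeff_one, if_neg]
  rintro rfl
  exact hn (by simp)

lemma Gr.pow {R : Type*} [CommRing R] {i : ZMod 4} {f : PowerSeries R} (hf : Gr i f) (k : ℕ) :
    Gr (k * i) (f ^ k) := by
  induction k with
  | zero => simpa using Gr.one
  | succ k ih =>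
    rw [pow_succ]
    convert ih.mul hf using 1
    push_cast; ring

lemma Gr.add {R : Type*} [CommRing R] {i : ZMod 4} {f g : PowerSeries R} (hf : Gr i f)
    (hg : Gr i g) : Gr i (f + g) := by
  intro n hn
  rw [map_add, hf n hn, hg n hn, add_zero]

lemma Gr_pp (R : Type*) [CommRing R] : Gr 0 (pp R) := by
  intro n hn
  rw [pp, Th, coeff_mk, cnt_supp0, Nat.cast_zero]
  intro h
  exact hn ((ZMod.natCast_eq_zero_iff n 4).2 (by omega))

lemma Gr_tt (R : Type*) [CommRing R] : Gr 1 (tt R) := by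
  intro n hn
  rw [tt, Th, coeff_mk, cnt_supp1, Nat.cast_zero]
  intro h
  apply hn
  have := (ZMod.natCast_eq_natCast_iff' n 1 4).2 (by omega)
  simpa using this

lemma pp_zero (R : Type*) [CommRing R] : coeff 0 (pp R) = 1 := by
  rw [pp, Th, coeff_mk]
  have : cnt (fun m => m % 2 = 0) 0 = 1 := by decide
  rw [this]; simp

lemma tt_zero (R : Type*) [CommRing R] : coeff 0 (tt R) = 0 := by
  rw [tt, Th, coeff_mk]
  have : cnt (fun m => m % 2 = 1) 0 = 0 := by decide
  rw [this]; simp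

lemma tt_one (R : Type*) [CommRing R] : coeff 1 (tt R) = 2 := by
  rw [tt, Th, coeff_mk]
  have : cnt (fun m => m % 2 = 1) 1 = 2 := by decide
  rw [this]; simp

noncomputable def dd {R : Type*} [CommRing R] (f : PowerSeries R) : PowerSeries R :=
  X * derivative R f

lemma coeff_dd {R : Type*} [CommRing R] (f : PowerSeries R) (n : ℕ) :
    coeff n (dd f) = n * coeff n f := by
  rw [dd]
  cases n with
  | zero => simp
  | succ n => rw [coeff_succ_X_mul, coeff_derivative]; push_cast; ring

lemma dd_add {R : Type*} [CommRing R] (f g : PowerSeries R) : dd (f + g) = dd f + dd g := by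
  simp [dd, mul_add]

lemma dd_sub {R : Type*} [CommRing R] (f g : PowerSeries R) : dd (f - g) = dd f - dd g := by
  simp [dd, mul_sub]

lemma dd_mul {R : Type*} [CommRing R] (f g : PowerSeries R) :
    dd (f * g) = f * dd g + g * dd f := by
  simp only [dd, Derivation.leibniz, smul_eq_mul]; ring

lemma dd_one {R : Type*} [CommRing R] : dd (1 : PowerSeries R) = 0 := by
  simp [dd]

lemma dd_pow {R : Type*} [CommRing R] (f : PowerSeries R) (n : ℕ) :
    dd (f ^ n) = n * f ^ (n - 1) * dd f := by
  simp only [dd, Derivation.leibniz_pow, smul_eq_mul, nsmul_eq_mul]; ring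

lemma dd_expand {R : Type*} [CommRing R] (f : PowerSeries R) :
    dd (expand 2 two_ne_zero f) = 2 * expand 2 two_ne_zero (dd f) := by
  ext n
  have : (2 : PowerSeries R) = C (2 : R) := (map_ofNat C 2).symm
  rw [coeff_dd, this, coeff_C_mul, coeff_expand, coeff_expand]
  split_ifs with h
  · obtain ⟨m, rfl⟩ := h
    rw [Nat.mul_div_cancel_left _ (by norm_num), coeff_dd]
    push_cast; ring
  · simp

abbrev F5 := ZMod 5

instance : Fact (Nat.Prime 5) := ⟨by norm_num⟩

lemma five_zero : (5 : PowerSeries F5) = 0 := by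
  have h : (5 : PowerSeries F5) = C (5 : F5) := (map_ofNat C 5).symm
  have h2 : (5 : F5) = 0 := by decide
  rw [h, h2, map_zero]

/-- A power series invariant under `X ↦ X²` is constant. -/
lemma const_of_expand {R : Type*} [CommRing R] (f : PowerSeries R)
    (h : f = expand 2 two_ne_zero f) : f = C (coeff 0 f) := by
  ext n
  induction n using Nat.strong_induction_on with
  | _ n ih =>
    rw [coeff_C]
    split_ifs with h0
    · rw [h0]
    · rw [h, coeff_expand]
      split_ifs with h2
      · rw [ih (n / 2) (by omega), coeff_C, if_neg (by omega)]
      · rfl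

lemma theta_one : (pp F5 ^ 4) ^ 2 - pp F5 ^ 4 * tt F5 ^ 4 + (tt F5 ^ 4) ^ 2 = 1 := by
  have h1 := landen1 F5
  have h2 := landen2 F5
  have h5 := five_zero
  have key := const_of_expand ((pp F5 ^ 4) ^ 2 - pp F5 ^ 4 * tt F5 ^ 4 + (tt F5 ^ 4) ^ 2) (by
    simp only [map_add, map_sub, map_mul, map_pow]
    generalize expand 2 two_ne_zero (pp F5) = a at *
    generalize expand 2 two_ne_zero (tt F5) = b at *
    have e1 : pp F5 ^ 4 = (a ^ 2 + b ^ 2) ^ 2 := by rw [← h1]; ring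
    have e2 : tt F5 ^ 4 = (2 * a * b) ^ 2 := by rw [← h2]; ring
    rw [e1, e2]
    linear_combination (3 * a ^ 4 * b ^ 4) * h5)
  rw [key, coeff_zero_eq_constantCoeff_apply]
  have hp : constantCoeff (pp F5) = 1 := by
    rw [← coeff_zero_eq_constantCoeff_apply]; exact pp_zero F5
  have ht : constantCoeff (tt F5) = 0 := by
    rw [← coeff_zero_eq_constantCoeff_apply]; exact tt_zero F5
  simp [hp, ht]

lemma coeff_one_mul' {R : Type*} [CommRing R] (f g : PowerSeries R) :
    coeff 1 (f * g) = coeff 0 f * coeff 1 g + coeff 1 f * coeff 0 g := by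
  rw [coeff_mul]
  simp [Finset.Nat.antidiagonal_succ]

lemma wronskian : pp F5 * dd (tt F5) - tt F5 * dd (pp F5)
    = pp F5 * tt F5 * (pp F5 ^ 4 - tt F5 ^ 4) := by
  rw [← sub_eq_zero]
  by_contra hN
  set N := pp F5 * dd (tt F5) - tt F5 * dd (pp F5) - pp F5 * tt F5 * (pp F5 ^ 4 - tt F5 ^ 4) with hNdef
  have h1 := landen1 F5
  have h2 := landen2 F5
  have hp : constantCoeff (pp F5) = 1 := by
    rw [← coeff_zero_eq_constantCoeff_apply]; exact pp_zero F5
  have ht : constantCoeff (tt F5) = 0 := by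
    rw [← coeff_zero_eq_constantCoeff_apply]; exact tt_zero F5
  have hfun : pp F5 * tt F5 * N = 2 * (expand 2 two_ne_zero (pp F5) ^ 2
      - expand 2 two_ne_zero (tt F5) ^ 2) * expand 2 two_ne_zero N := by
    have d1 := congrArg dd h1
    have d2 := congrArg dd h2
    have d3 : dd (2 : PowerSeries F5) = 0 := by
      rw [show (2 : PowerSeries F5) = 1 + 1 by norm_num, dd_add, dd_one, add_zero]
    simp only [dd_add, dd_pow, dd_mul, d3, dd_expand] at d1 d2
    rw [hNdef]
    simp only [map_add, map_sub, map_mul, map_pow]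
    generalize expand 2 two_ne_zero (pp F5) = a at *
    generalize expand 2 two_ne_zero (tt F5) = b at *
    generalize expand 2 two_ne_zero (dd (pp F5)) = a' at *
    generalize expand 2 two_ne_zero (dd (tt F5)) = b' at *
    have e1 : pp F5 * dd (pp F5) = 2 * (a * a' + b * b') := by
      norm_num at d1
      linear_combination 3 * d1 - (pp F5 * dd (pp F5) - 2 * (a * a' + b * b')) * five_zero
    have e2 : tt F5 * dd (tt F5) = 2 * (b * a' + a * b') := by
      norm_num at d2
      linear_combination 3 * d2 - (tt F5 * dd (tt F5) - 2 * (b * a' + a * b')) * five_zero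
    have l : ∀ p t p' t' : PowerSeries F5, p ^ 2 = a ^ 2 + b ^ 2 → t ^ 2 = 2 * a * b →
        p * p' = 2 * (a * a' + b * b') → t * t' = 2 * (b * a' + a * b') →
        p * t * (p * t' - t * p' - p * t * (p ^ 4 - t ^ 4)) =
        2 * (a ^ 2 - b ^ 2) * (a * b' - b * a' - a * b * (a ^ 4 - b ^ 4)) := by
      intro p t p' t' h1 h2 h3 h4
      calc p * t * (p * t' - t * p' - p * t * (p ^ 4 - t ^ 4))
          = p ^ 2 * (t * t') - t ^ 2 * (p * p') - p ^ 2 * t ^ 2 * ((p ^ 2) ^ 2 - (t ^ 2) ^ 2) := by ring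
        _ = _ := by rw [h1, h2, h3, h4]; ring
    exact l _ _ _ _ h1 h2 e1 e2
  -- orders
  have o := congrArg order hfun
  have ot : (tt F5).order = (1 : ℕ) := by
    rw [order_eq_nat]
    refine ⟨by rw [tt_one]; decide, ?_⟩
    intro i hi
    rw [Nat.lt_one_iff.1 hi]; exact tt_zero F5
  have ounit : ∀ f : PowerSeries F5, constantCoeff f ≠ 0 → f.order = 0 := by
    intro f hf
    by_contra h
    exact hf (order_ne_zero_iff_constCoeff_eq_zero.1 h)
  rw [order_mul, order_mul, order_mul, order_expand, ot, ounit (pp F5) (by rw [hp]; decide),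
    ounit (2 * _)] at o
  · obtain ⟨k, hk⟩ : ∃ k : ℕ, N.order = k := by
      have : N.order ≠ ⊤ := by rwa [Ne, order_eq_top]
      exact ⟨_, (ENat.natCast_toNat this).symm⟩
    rw [hk] at o
    have hk1 : k = 1 := by
      have : ((1 + k : ℕ) : ℕ∞) = ((2 * k : ℕ) : ℕ∞) := by
        push_cast
        simpa using o
      have := ENat.natCast_inj.1 this
      omega
    rw [hk1, order_eq_nat] at hk
    apply hk.1
    rw [hNdef]
    simp only [map_sub, coeff_one_mul', coeff_dd, pp_zero, tt_zero, tt_one]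
    simp [hp, ht]
  · simp only [map_mul, map_sub, map_pow, constantCoeff_expand, hp, ht, map_ofNat]
    decide

lemma cong5_aux (n : ℕ) (hn : (n : F5) ^ 2 = 1) (p t : PowerSeries F5)
    (hT : (p ^ 4) ^ 2 - p ^ 4 * t ^ 4 + (t ^ 4) ^ 2 = 1)
    (hW : p * dd t - t * dd p = p * t * (p ^ 4 - t ^ 4)) :
    coeff n (p ^ 2 * t ^ 2 * ((p ^ 4) ^ 5 + (p ^ 4) ^ 4 * t ^ 4 + (p ^ 4) ^ 3 * (t ^ 4) ^ 2
      + (p ^ 4) ^ 2 * (t ^ 4) ^ 3 + p ^ 4 * (t ^ 4) ^ 4 + (t ^ 4) ^ 5)) = 0 := by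
  have h5 := five_zero
  obtain ⟨u, hu⟩ : ∃ u, u = p ^ 4 := ⟨_, rfl⟩
  obtain ⟨v, hv⟩ : ∃ v, v = t ^ 4 := ⟨_, rfl⟩
  obtain ⟨S, hS⟩ : ∃ S, S = u + v := ⟨_, rfl⟩
  obtain ⟨E, hE⟩ : ∃ E, E = S * (u ^ 2 + u * v + v ^ 2) := ⟨_, rfl⟩
  obtain ⟨B, hB⟩ : ∃ B, B = p ^ 2 * t ^ 2 := ⟨_, rfl⟩
  have dT := congrArg dd hT
  simp only [dd_add, dd_sub, dd_mul, dd_pow, dd_one] at dT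
  norm_num at dT
  rw [← hu, ← hv] at hT hW ⊢
  have dp : dd p = p * (E - u) := by
    have e : 8 * (u ^ 2 - u * v + v ^ 2) * dd p + (8 * v ^ 2 - 4 * u * v) * (p * (u - v)) = 0 := by
      subst hu hv
      linear_combination p * dT - (8 * t ^ 7 - 4 * p ^ 4 * t ^ 3) * hW
    rw [hT] at e
    rw [hE, hS]
    linear_combination 2 * e - 3 * dd p * h5 - p * u * hT
      + p * (u ^ 2 * v - 5 * u * v ^ 2 + 3 * v ^ 3) * h5
  have dt : dd t = t * (E - v) := by
    have e : 8 * (u ^ 2 - u * v + v ^ 2) * dd t + (8 * u ^ 2 - 4 * u * v) * (t * (v - u)) = 0 := by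
      subst hu hv
      linear_combination t * dT + (8 * p ^ 7 - 4 * p ^ 3 * t ^ 4) * hW
    rw [hT] at e
    rw [hE, hS]
    linear_combination 2 * e - 3 * dd t * h5 - t * v * hT
      + t * (v ^ 2 * u - 5 * v * u ^ 2 + 3 * u ^ 3) * h5
  have du : dd u = u * (u - E) := by
    have e : dd u = 4 * p ^ 3 * dd p := by rw [hu, dd_pow]; norm_num
    rw [e, dp]
    linear_combination (-4 * (E - u)) * hu + u * (E - u) * h5
  have dv : dd v = v * (v - E) := by
    have e : dd v = 4 * t ^ 3 * dd t := by rw [hv, dd_pow]; norm_num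
    rw [e, dt]
    linear_combination (-4 * (E - v)) * hv + v * (E - v) * h5
  have dB : dd B = B * (4 * E - 2 * S) := by
    rw [hB, dd_mul, dd_pow, dd_pow, dp, dt, hS]
    norm_num
    ring
  have dS : dd S = u ^ 2 + v ^ 2 - E * S := by
    rw [hS, dd_add, du, dv]; ring
  have dE : dd E = 2 * E ^ 2 + 3 := by
    have : dd E = - 3 * E ^ 2 + (3 * u ^ 4 + 4 * u ^ 3 * v + 4 * u ^ 2 * v ^ 2 + 4 * u * v ^ 3 + 3 * v ^ 4) := by
      conv_lhs => rw [hE]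
      simp only [dd_add, dd_mul, dd_pow, dS, du, dv]
      norm_num
      rw [hS] at hE ⊢
      linear_combination 3 * E * hE
    rw [this]
    linear_combination (- E ^ 2 + 2 * u ^ 3 * v - u ^ 2 * v ^ 2 + 2 * u * v ^ 3) * h5 + 3 * (u ^ 2 - u * v + v ^ 2 + 1) * hT
  have dg : dd (B * S) = B * (3 * E * S - 1) := by
    rw [dd_mul, dB, dS, hS]
    linear_combination (-B) * hT - B * u * v * h5
  have ddg : dd (dd (B * S)) = B * (S - 2 * E) := by
    have d3 : dd (3 : PowerSeries F5) = 0 := by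
      rw [show (3 : PowerSeries F5) = 1 + 1 + 1 by norm_num, dd_add, dd_add, dd_one]; simp
    rw [dg, dd_mul, dB, dd_sub, dd_mul, dd_mul, dE, dS, d3, dd_one]
    rw [hS]
    linear_combination B * (3 * E ^ 2 * (u + v) + 2 * (u + v) - E - 3 * E * u * v) * h5
      - 3 * B * E * hT
  have fin : B * (u ^ 5 + u ^ 4 * v + u ^ 3 * v ^ 2 + u ^ 2 * v ^ 3 + u * v ^ 4 + v ^ 5)
      = 3 * (B * S - dd (dd (B * S))) := by
    rw [ddg]
    have : u ^ 5 + u ^ 4 * v + u ^ 3 * v ^ 2 + u ^ 2 * v ^ 3 + u * v ^ 4 + v ^ 5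
      = E * (u ^ 2 - u * v + v ^ 2) := by rw [hE, hS]; ring
    rw [this, hT]
    linear_combination (- B * E) * h5
  rw [← hB, fin]
  have h3 : (3 : PowerSeries F5) = C (3 : F5) := (map_ofNat C 3).symm
  rw [h3, coeff_C_mul, map_sub, coeff_dd, coeff_dd]
  linear_combination (-3 * coeff n (B * S)) * hn

lemma cong5 (A : PowerSeries F5) (hA : A * (pp F5 - tt F5) = (pp F5 - tt F5) ^ 25) (n : ℕ)
    (h4 : n % 4 = 2) (h5 : n % 5 = 1 ∨ n % 5 = 4) : coeff n A = 0 := by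
  have hn : (n : F5) ^ 2 = 1 := by
    rw [← Nat.div_add_mod n 5]
    have h0 : ((5 : ℕ) : F5) = 0 := by decide
    rw [Nat.cast_add, Nat.cast_mul, h0, zero_mul, zero_add]
    rcases h5 with h | h <;> rw [h] <;> decide
  have main := cong5_aux n hn (pp F5) (tt F5) theta_one wronskian
  have hp := Gr_pp F5
  have ht := Gr_tt F5
  have hne : pp F5 - tt F5 ≠ 0 := by
    intro h
    have := congrArg (coeff 0) h
    rw [map_sub, pp_zero, tt_zero] at this
    simp at this
  generalize pp F5 = p at *
  generalize tt F5 = t at *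
  haveI : CharP (PowerSeries F5) 5 := charP_of_injective_ringHom (f := C (R := F5)) C_injective 5
  have hpow : (p - t) ^ 25 = p ^ 25 - t ^ 25 := sub_pow_char_pow (p := 5) p t 2
  have hu : Gr 0 (p ^ 4) := by simpa using hp.pow 4
  have hv : Gr 0 (t ^ 4) := by
    have := ht.pow 4
    rwa [show ((4 : ℕ) : ZMod 4) * 1 = 0 by decide] at this
  generalize hQ : ((p ^ 4) ^ 5 + (p ^ 4) ^ 4 * t ^ 4 + (p ^ 4) ^ 3 * (t ^ 4) ^ 2
      + (p ^ 4) ^ 2 * (t ^ 4) ^ 3 + p ^ 4 * (t ^ 4) ^ 4 + (t ^ 4) ^ 5) = Q at main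
  have hm : ∀ f g : PowerSeries F5, Gr 0 f → Gr 0 g → Gr 0 (f * g) := by
    intro f g hf hg
    simpa using hf.mul hg
  have hk : ∀ (f : PowerSeries F5) (k : ℕ), Gr 0 f → Gr 0 (f ^ k) := by
    intro f k hf
    simpa using hf.pow k
  have gQ : Gr 0 Q := by
    rw [← hQ]
    exact ((((((hk _ 5 hu).add (hm _ _ (hk _ 4 hu) hv)).add (hm _ _ (hk _ 3 hu) (hk _ 2 hv))).add
      (hm _ _ (hk _ 2 hu) (hk _ 3 hv))).add (hm _ _ hu (hk _ 4 hv))).add (hk _ 5 hv))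
  have g0 : Gr 0 (p ^ 4 * Q + (t ^ 4) ^ 6) := (hm _ _ hu gQ).add (hk _ 6 hv)
  have g1 : Gr 1 (p ^ 3 * t * Q) := by
    have := ((hk _ 3 hp).mul ht).mul gQ
    simpa using this
  have g3 : Gr 3 (p * t ^ 3 * Q) := by
    have := (hp.mul (ht.pow 3)).mul gQ
    simpa using this
  have hAeq : A = (p ^ 4 * Q + (t ^ 4) ^ 6) + p ^ 3 * t * Q + p ^ 2 * t ^ 2 * Q + p * t ^ 3 * Q := by
    apply mul_right_cancel₀ hne
    rw [hA, hpow, ← hQ]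
    ring
  have n4 : (n : ZMod 4) = 2 := by
    have := (ZMod.natCast_eq_natCast_iff' n 2 4).2 (by omega)
    simpa using this
  rw [hAeq, map_add, map_add, map_add, main, g0 n (by rw [n4]; decide), g1 n (by rw [n4]; decide),
    g3 n (by rw [n4]; decide)]
  simp

/-- finite product -/
noncomputable def Pq (q : ℂ) (n : ℕ) : ℂ :=
  ∏ k ∈ Finset.range n, ((1 - q ^ (k + 1)) / (1 + q ^ (k + 1)))

lemma one_sub_ne {q : ℂ} (hq : ‖q‖ < 1) (k : ℕ) : 1 - q ^ (k + 1) ≠ 0 := by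
  intro h
  have h1 : q ^ (k + 1) = 1 := by linear_combination -h
  have h2 : ‖q‖ ^ (k + 1) = 1 := by rw [← norm_pow, h1, norm_one]
  have h3 : ‖q‖ ^ (k + 1) < 1 := pow_lt_one₀ (norm_nonneg q) hq (by omega)
  linarith

lemma one_add_ne {q : ℂ} (hq : ‖q‖ < 1) (k : ℕ) : 1 + q ^ k ≠ 0 := by
  rcases k with _ | k
  · norm_num
  intro h
  have h1 : q ^ (k + 1) = -1 := by linear_combination h
  have h2 : ‖q‖ ^ (k + 1) = 1 := by rw [← norm_pow, h1, norm_neg, norm_one]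
  have h3 : ‖q‖ ^ (k + 1) < 1 := pow_lt_one₀ (norm_nonneg q) hq (by omega)
  linarith

lemma Pq_ne {q : ℂ} (hq : ‖q‖ < 1) (n : ℕ) : Pq q n ≠ 0 :=
  Finset.prod_ne_zero_iff.2 fun k _ => div_ne_zero (one_sub_ne hq k) (one_add_ne hq (k + 1))

lemma Pq_succ (q : ℂ) (n : ℕ) : Pq q (n + 1) = Pq q n * ((1 - q ^ (n + 1)) / (1 + q ^ (n + 1))) := by
  rw [Pq, Finset.prod_range_succ, Pq]

lemma shanks_tel {q : ℂ} (hq : ‖q‖ < 1) (n m : ℕ) :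
    ∑ s ∈ Finset.range m, ((-1) ^ s * (2 / (1 + q ^ s)) / Pq q s * q ^ (s * (n + 1)) *
      (Pq q (n + 1) * q ^ s - Pq q n)) =
    2 * Pq q n / (1 + q ^ (n + 1)) * ((-1) ^ m * q ^ (m * (n + 1)) * (1 - q ^ m) /
      ((1 + q ^ m) * Pq q m)) := by
  induction m with
  | zero => simp
  | succ m ih =>
    rw [Finset.sum_range_succ, ih, Pq_succ q m, Pq_succ q n]
    have h1 := Pq_ne hq m
    have h2 := one_add_ne hq m
    have h3 := one_add_ne hq (m + 1)
    have h4 := one_add_ne hq (n + 1)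
    have h5 := one_sub_ne hq m
    have e : q ^ ((m + 1) * (n + 1)) = q ^ (m * (n + 1)) * q ^ (n + 1) := by
      rw [← pow_add]; ring_nf
    rw [e, pow_succ (-1 : ℂ) m]
    generalize q ^ (m + 1) = x at *
    generalize q ^ (n + 1) = y at *
    generalize q ^ (m * (n + 1)) = w at *
    generalize q ^ m = z at *
    generalize Pq q m = P at *
    generalize Pq q n = Q at *
    field_simp
    ring

/-- partial theta sums -/
noncomputable def Sq (q : ℂ) (n : ℕ) : ℂ :=
  1 + ∑ s ∈ Finset.range n, 2 * (-1) ^ (s + 1) * q ^ ((s + 1) ^ 2)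

lemma shanks {q : ℂ} (hq : ‖q‖ < 1) (n : ℕ) :
    ∑ s ∈ Finset.range (n + 1), ((-1) ^ s * (2 / (1 + q ^ s)) / Pq q s * q ^ (s * (n + 1)) * Pq q n)
      = Sq q n := by
  induction n with
  | zero => simp [Sq, Pq]; norm_num
  | succ n ih =>
    have hS : Sq q (n + 1) = Sq q n + 2 * (-1) ^ (n + 1) * q ^ ((n + 1) ^ 2) := by
      rw [Sq, Finset.sum_range_succ, Sq]; ring
    rw [Finset.sum_range_succ, hS, ← ih]
    have ht := shanks_tel hq n (n + 1)
    have hs : ∑ s ∈ Finset.range (n + 1), ((-1) ^ s * (2 / (1 + q ^ s)) / Pq q s *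
        q ^ (s * (n + 1 + 1)) * Pq q (n + 1)) =
        ∑ s ∈ Finset.range (n + 1), ((-1) ^ s * (2 / (1 + q ^ s)) / Pq q s *
        q ^ (s * (n + 1)) * Pq q n) +
        ∑ s ∈ Finset.range (n + 1), ((-1) ^ s * (2 / (1 + q ^ s)) / Pq q s * q ^ (s * (n + 1)) *
      (Pq q (n + 1) * q ^ s - Pq q n)) := by
      rw [← Finset.sum_add_distrib]
      refine Finset.sum_congr rfl fun s _ => ?_
      rw [show s * (n + 1 + 1) = s * (n + 1) + s by ring, pow_add]
      ring
    rw [hs, ht, add_assoc]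
    congr 1
    have h1 := Pq_ne hq n
    have h1' := Pq_ne hq (n + 1)
    have h4 := one_add_ne hq (n + 1)
    have h5 := one_sub_ne hq n
    rw [show (n + 1) * (n + 1 + 1) = (n + 1) ^ 2 + (n + 1) by ring, ← sq (n + 1),
      pow_add q ((n + 1) ^ 2) (n + 1), Pq_succ]
    clear hs ht hS ih h1'
    generalize q ^ (n + 1) = y at *
    generalize q ^ ((n + 1) ^ 2) = w at *
    generalize Pq q n = Q at *
    field_simp

lemma qpoch_ne {q : ℂ} (hq : ‖q‖ < 1) : qpoch q q ≠ 0 := by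
  have hs : Summable fun k : ℕ => ‖-(q * q ^ k)‖ := by
    simp only [norm_neg, norm_mul, norm_pow]
    exact (summable_geometric_of_lt_one (norm_nonneg q) hq).mul_left _
  have := tprod_one_add_ne_zero_of_summable (f := fun k : ℕ => -(q * q ^ k))
    (fun k => by simpa [sub_eq_add_neg, pow_succ'] using one_sub_ne hq k) hs
  simpa [qpoch, sub_eq_add_neg] using this

lemma qpoch_tendsto {q : ℂ} (hq : ‖q‖ < 1) :
    Filter.Tendsto (fun n => ∏ k ∈ Finset.range n, (1 - q ^ (k + 1))) Filter.atTop
      (nhds (qpoch q q)) := by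
  have hs : Summable fun k : ℕ => ‖-(q * q ^ k)‖ := by
    simp only [norm_neg, norm_mul, norm_pow]
    exact (summable_geometric_of_lt_one (norm_nonneg q) hq).mul_left _
  have := (multipliable_one_add_of_summable hs).hasProd.tendsto_prod_nat
  simpa [qpoch, sub_eq_add_neg, pow_succ'] using this

lemma sq_norm_lt {q : ℂ} (hq : ‖q‖ < 1) {k : ℕ} (hk : k ≠ 0) : ‖q ^ k‖ < 1 := by
  rw [norm_pow]; exact pow_lt_one₀ (norm_nonneg q) hq hk

lemma phiNeg_ne {q : ℂ} (hq : ‖q‖ < 1) : phiNeg q ≠ 0 :=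
  div_ne_zero (pow_ne_zero _ (qpoch_ne hq)) (qpoch_ne (sq_norm_lt hq two_ne_zero))

lemma Pq_tendsto {q : ℂ} (hq : ‖q‖ < 1) :
    Filter.Tendsto (Pq q) Filter.atTop (nhds (phiNeg q)) := by
  have h1 := (qpoch_tendsto hq).pow 2
  have h2 := qpoch_tendsto (sq_norm_lt hq two_ne_zero)
  refine (h1.div h2 (qpoch_ne (sq_norm_lt hq two_ne_zero))).congr fun n => ?_
  simp only [Pi.div_apply]
  rw [Pq, ← Finset.prod_pow, ← Finset.prod_div_distrib]
  refine Finset.prod_congr rfl fun k _ => ?_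
  have h4 := one_add_ne hq (k + 1)
  have h5 := one_sub_ne hq k
  have : 1 - (q ^ 2) ^ (k + 1) = (1 - q ^ (k + 1)) * (1 + q ^ (k + 1)) := by ring
  rw [this]
  field_simp

lemma Sq_tendsto {q : ℂ} (hq : ‖q‖ < 1) :
    Filter.Tendsto (Sq q) Filter.atTop (nhds (phiNeg q)) := by
  obtain ⟨C1, hC1⟩ := (Pq_tendsto hq).norm.bddAbove_range
  obtain ⟨C2, hC2⟩ := ((Pq_tendsto hq).inv₀ (phiNeg_ne hq)).norm.bddAbove_range
  have hC1' : ∀ n, ‖Pq q n‖ ≤ C1 := fun n => hC1 ⟨n, rfl⟩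
  have hC2' : ∀ n, ‖(Pq q n)⁻¹‖ ≤ C2 := fun n => hC2 ⟨n, rfl⟩
  have hc1 : 0 ≤ C1 := (norm_nonneg _).trans (hC1' 0)
  have hc2 : 0 ≤ C2 := (norm_nonneg _).trans (hC2' 0)
  have hden : ∀ s, ‖(2 : ℂ) / (1 + q ^ (s + 1))‖ ≤ 2 / (1 - ‖q‖) := by
    intro s
    rw [norm_div, Complex.norm_ofNat]
    have : 1 - ‖q‖ ≤ ‖1 + q ^ (s + 1)‖ := by
      have h1 : ‖(1:ℂ)‖ - ‖q ^ (s + 1)‖ ≤ ‖1 + q ^ (s + 1)‖ := by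
        have := norm_sub_norm_le (1:ℂ) (-q ^ (s + 1))
        simpa [norm_neg] using this
      have h2 : ‖q ^ (s + 1)‖ ≤ ‖q‖ := by
        rw [norm_pow]
        exact pow_le_of_le_one (norm_nonneg q) hq.le (by omega)
      rw [norm_one] at h1
      linarith
    exact div_le_div_of_nonneg_left (by norm_num) (by linarith) this
  have hlim : Filter.Tendsto (fun n => Sq q n - Pq q n) Filter.atTop (nhds 0) := by
    have hb : Filter.Tendsto (fun n : ℕ => (n : ℝ) * ‖q‖ ^ n * (2 / (1 - ‖q‖) * C2 * C1))
        Filter.atTop (nhds 0) := by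
      simpa using (tendsto_self_mul_const_pow_of_lt_one (norm_nonneg q) hq).mul_const
        (2 / (1 - ‖q‖) * C2 * C1)
    refine squeeze_zero_norm (fun n => ?_) hb
    rw [← shanks hq n, Finset.sum_range_succ']
    have h0 : ((-1 : ℂ) ^ 0 * (2 / (1 + q ^ 0)) / Pq q 0 * q ^ (0 * (n + 1)) * Pq q n) = Pq q n := by
      simp [Pq]; norm_num
    rw [h0, add_sub_cancel_right]
    refine (norm_sum_le _ _).trans ?_
    refine (Finset.sum_le_card_nsmul _ _ (‖q‖ ^ n * (2 / (1 - ‖q‖) * C2 * C1)) ?_).trans ?_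
    · intro s _
      rw [div_eq_mul_inv]
      simp only [norm_mul, norm_pow, norm_neg, norm_one, one_pow, one_mul]
      have e1 : ‖q‖ ^ ((s + 1) * (n + 1)) ≤ ‖q‖ ^ n :=
        pow_le_pow_of_le_one (norm_nonneg q) hq.le (by nlinarith)
      have e2 := hden s
      have e3 := hC2' (s + 1)
      have e4 := hC1' n
      have e5 : 0 ≤ 2 / (1 - ‖q‖) := div_nonneg (by norm_num) (by linarith)
      calc _ ≤ 2 / (1 - ‖q‖) * C2 * ‖q‖ ^ n * C1 := by gcongr
        _ = _ := by ring
    · rw [Finset.card_range, nsmul_eq_mul, ← mul_assoc]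
  simpa using hlim.add (Pq_tendsto hq)

lemma cnt_sq (P : ℤ → Prop) [DecidablePred P] (s : ℕ) (hs : 0 < s) (hP : P (-(s:ℤ)) ↔ P s) :
    cnt P (s ^ 2) = if P s then 2 else 0 := by
  rw [cnt]
  split_ifs with h
  · have : ((Finset.Icc (-((s ^ 2 : ℕ):ℤ)) (s ^ 2 : ℕ)).filter
        (fun m => P m ∧ m ^ 2 = ((s ^ 2 : ℕ) : ℤ))) = {(s:ℤ), -(s:ℤ)} := by
      ext m
      simp only [Finset.mem_filter, Finset.mem_Icc, Finset.mem_insert, Finset.mem_singleton]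
      constructor
      · rintro ⟨_, _, h2⟩
        push_cast at h2
        exact sq_eq_sq_iff_eq_or_eq_neg.1 h2
      · intro hm
        have h2 : m ^ 2 = ((s ^ 2 : ℕ) : ℤ) := by
          push_cast
          exact sq_eq_sq_iff_eq_or_eq_neg.2 hm
        refine ⟨mem_box h2.le, ?_, h2⟩
        rcases hm with rfl | rfl
        · exact h
        · exact hP.2 h
    rw [this, Finset.card_pair (by omega)]
  · rw [Finset.card_eq_zero, Finset.filter_eq_empty_iff]
    rintro m _ ⟨h1, h2⟩
    push_cast at h2
    rcases sq_eq_sq_iff_eq_or_eq_neg.1 h2 with rfl | rfl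
    · exact h h1
    · exact h (hP.1 h1)

lemma cnt_nonsq (P : ℤ → Prop) [DecidablePred P] (n : ℕ) (hn : ¬ ∃ s : ℕ, s ^ 2 = n) :
    cnt P n = 0 := by
  rw [cnt, Finset.card_eq_zero, Finset.filter_eq_empty_iff]
  rintro m _ ⟨_, h2⟩
  refine hn ⟨m.natAbs, ?_⟩
  zify
  rw [sq_abs]; exact h2

/-- coefficients of `φ(-q)` -/
noncomputable abbrev TH (R : Type*) [CommRing R] : PowerSeries R := pp R - tt R

lemma TH_zero (R : Type*) [CommRing R] : coeff 0 (TH R) = 1 := by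
  rw [TH, map_sub, pp_zero, tt_zero, sub_zero]

lemma TH_sq (R : Type*) [CommRing R] (s : ℕ) (hs : 0 < s) :
    coeff (s ^ 2) (TH R) = 2 * (-1) ^ s := by
  rw [TH, map_sub, pp, tt, Th, Th, coeff_mk, coeff_mk, cnt_sq _ s hs (by omega),
    cnt_sq _ s hs (by omega)]
  rcases Nat.even_or_odd s with h | h
  · rw [if_pos (by obtain ⟨k, rfl⟩ := h; omega), if_neg (by obtain ⟨k, rfl⟩ := h; omega), h.neg_one_pow]
    simp
  · rw [if_neg (by obtain ⟨k, rfl⟩ := h; omega), if_pos (by obtain ⟨k, rfl⟩ := h; omega), h.neg_one_pow]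
    simp

lemma TH_nonsq (R : Type*) [CommRing R] (n : ℕ) (hn : ¬ ∃ s : ℕ, s ^ 2 = n) :
    coeff n (TH R) = 0 := by
  rw [TH, map_sub, pp, tt, Th, Th, coeff_mk, coeff_mk, cnt_nonsq _ n hn, cnt_nonsq _ n hn]
  simp

lemma TH_norm (n : ℕ) : ‖coeff n (TH ℂ)‖ ≤ 2 := by
  by_cases hn : ∃ s : ℕ, s ^ 2 = n
  · obtain ⟨s, rfl⟩ := hn
    rcases Nat.eq_zero_or_pos s with rfl | hs
    · rw [show 0 ^ 2 = 0 from rfl, TH_zero]; simp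
    · rw [TH_sq _ s hs]; simp
  · rw [TH_nonsq _ n hn]; simp

/-- `F` converges absolutely at `q` with value `v`. -/
def EvAt (F : PowerSeries ℂ) (q v : ℂ) : Prop :=
  Summable (fun n => ‖coeff n F * q ^ n‖) ∧ ∑' n, coeff n F * q ^ n = v

lemma EvAt.mul {F G : PowerSeries ℂ} {q v w : ℂ} (hF : EvAt F q v) (hG : EvAt G q w) :
    EvAt (F * G) q (v * w) := by
  have e : ∀ n, coeff n (F * G) * q ^ n = ∑ kl ∈ Finset.HasAntidiagonal.antidiagonal n,
      (coeff kl.1 F * q ^ kl.1) * (coeff kl.2 G * q ^ kl.2) := by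
    intro n
    rw [coeff_mul, Finset.sum_mul]
    refine Finset.sum_congr rfl fun kl h => ?_
    rw [← Finset.HasAntidiagonal.mem_antidiagonal.1 h, pow_add]
    ring
  have h1 := summable_norm_sum_mul_antidiagonal_of_summable_norm
    (f := fun n => coeff n F * q ^ n) (g := fun n => coeff n G * q ^ n) hF.1 hG.1
  have h2 := tsum_mul_tsum_eq_tsum_sum_antidiagonal_of_summable_norm
    (f := fun n => coeff n F * q ^ n) (g := fun n => coeff n G * q ^ n) hF.1 hG.1
  rw [hF.2, hG.2] at h2
  constructor
  · refine h1.congr fun n => ?_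
    rw [e n]
  · rw [h2]
    exact tsum_congr e

lemma EvAt.one (q : ℂ) : EvAt 1 q 1 := by
  have h : ∀ n, n ≠ 0 → coeff n (1 : PowerSeries ℂ) * q ^ n = 0 := by
    intro n hn; rw [coeff_one, if_neg hn, zero_mul]
  constructor
  · exact summable_of_ne_finset_zero (s := {0}) fun n hn => by
      rw [h n (by simpa using hn), norm_zero]
  · rw [tsum_eq_single 0 h]; simp

lemma EvAt.pow {F : PowerSeries ℂ} {q v : ℂ} (hF : EvAt F q v) (k : ℕ) :
    EvAt (F ^ k) q (v ^ k) := by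
  induction k with
  | zero => simpa using EvAt.one q
  | succ k ih => rw [pow_succ, pow_succ]; exact ih.mul hF

lemma EvAt.expand {F : PowerSeries ℂ} {q v : ℂ} (hF : EvAt F (q ^ 5) v) :
    EvAt (PowerSeries.expand 5 (by norm_num) F) q v := by
  have hinj : Function.Injective (fun n : ℕ => 5 * n) := fun a b h => by
    simp only at h; omega
  have h0 : ∀ n ∉ Set.range (fun n : ℕ => 5 * n),
      coeff n (PowerSeries.expand 5 (by norm_num) F) * q ^ n = 0 := by
    intro n hn
    rw [coeff_expand_of_not_dvd, zero_mul]
    rintro ⟨k, rfl⟩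
    exact hn ⟨k, rfl⟩
  have h1 : ∀ n, coeff (5 * n) (PowerSeries.expand 5 (by norm_num) F) * q ^ (5 * n) =
      coeff n F * (q ^ 5) ^ n := by
    intro n
    rw [coeff_expand_mul, pow_mul]
  constructor
  · rw [← hinj.summable_iff (fun n hn => by rw [h0 n hn, norm_zero])]
    refine hF.1.congr fun n => ?_
    simp only [Function.comp_apply]
    rw [h1]
  · rw [← hF.2, ← hinj.tsum_eq]
    · exact tsum_congr h1
    · intro n hn
      by_contra h
      exact hn (h0 n h)

lemma EvAt.unique {F G : PowerSeries ℂ} {v : ℂ → ℂ} (hF : ∀ q, ‖q‖ < 1 → EvAt F q (v q))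
    (hG : ∀ q, ‖q‖ < 1 → EvAt G q (v q)) : F = G := by
  set h : ℕ → ℂ := fun n => coeff n F - coeff n G with hh
  have hs : ∀ q : ℂ, ‖q‖ < 1 → ∑' n, h n * q ^ n = 0 := by
    intro q hq
    have := (hF q hq).1.of_norm.tsum_sub (hG q hq).1.of_norm
    rw [(hF q hq).2, (hG q hq).2, sub_self] at this
    rw [← this]
    exact tsum_congr fun n => by rw [hh]; ring
  have hsum : Summable fun n => ‖h n‖ * (1 / 2 : ℝ) ^ n := by
    have hq : ‖(1 / 2 : ℂ)‖ < 1 := by norm_num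
    refine ((hF _ hq).1.add (hG _ hq).1).of_nonneg_of_le (fun n => by positivity) fun n => ?_
    simp only [norm_mul, norm_pow, hh]
    rw [← add_mul]
    have : ‖(1 / 2 : ℂ)‖ = 1 / 2 := by norm_num
    rw [this]
    gcongr
    exact norm_sub_le _ _
  set p := FormalMultilinearSeries.ofScalars ℂ h with hp
  have hr : ((1 / 2 : NNReal) : ENNReal) ≤ p.radius := by
    apply FormalMultilinearSeries.le_radius_of_summable
    simpa [hp, FormalMultilinearSeries.ofScalars_norm] using hsum
  have hpos : 0 < p.radius := lt_of_lt_of_le (by simp) hr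
  have hfp := (p.hasFPowerSeriesOnBall hpos).hasFPowerSeriesAt
  have hz : p = 0 := by
    apply hfp.eq_zero_of_eventually
    filter_upwards [Metric.ball_mem_nhds (0:ℂ) one_pos] with q hq
    have hq' : ‖q‖ < 1 := by simpa using hq
    have := hs q hq'
    have e : p.sum q = ∑' n, h n * q ^ n := by
      have := congrFun (FormalMultilinearSeries.ofScalarsSum_eq_tsum (E := ℂ) h) q
      simpa [FormalMultilinearSeries.ofScalarsSum, smul_eq_mul] using this
    rw [e, this]; rfl
  rw [hp, FormalMultilinearSeries.ofScalars_series_eq_zero] at hz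
  ext n
  have := congrFun hz n
  simpa [hh, sub_eq_zero] using this

lemma TH_ev {q : ℂ} (hq : ‖q‖ < 1) : EvAt (TH ℂ) q (phiNeg q) := by
  have hsum : Summable (fun n => ‖coeff n (TH ℂ) * q ^ n‖) := by
    refine ((summable_geometric_of_lt_one (norm_nonneg q) hq).mul_left 2).of_nonneg_of_le
      (fun n => norm_nonneg _) fun n => ?_
    rw [norm_mul, norm_pow]
    have := TH_norm n
    gcongr
  refine ⟨hsum, ?_⟩
  have hinj : Function.Injective (fun n : ℕ => n ^ 2) := Nat.pow_left_injective two_ne_zero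
  have h0 : ∀ n ∉ Set.range (fun n : ℕ => n ^ 2), coeff n (TH ℂ) * q ^ n = 0 := by
    intro n hn
    rw [TH_nonsq _ n (fun ⟨s, hs⟩ => hn ⟨s, hs⟩), zero_mul]
  have h1 := (hinj.hasSum_iff h0).2 hsum.of_norm.hasSum
  have h2 := (Filter.tendsto_add_atTop_iff_nat 1).2 h1.tendsto_sum_nat
  refine tendsto_nhds_unique h2 ((Sq_tendsto hq).congr fun n => ?_)
  rw [Finset.sum_range_succ', Sq, add_comm]
  congr 1
  · refine Finset.sum_congr rfl fun s _ => ?_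
    simp only [Function.comp_apply]
    rw [TH_sq _ _ (Nat.succ_pos s)]
  · simp only [Function.comp_apply]
    rw [show 0 ^ 2 = 0 from rfl, TH_zero]; simp

lemma map_Th {R S : Type*} [CommRing R] [CommRing S] (f : R →+* S) (P : ℤ → Prop)
    [DecidablePred P] : PowerSeries.map f (Th R P) = Th S P := by
  ext n; simp [Th]

lemma map_TH {R S : Type*} [CommRing R] [CommRing S] (f : R →+* S) :
    PowerSeries.map f (TH R) = TH S := by
  rw [TH, map_sub, map_Th, map_Th]

lemma expand_F5 (F : PowerSeries F5) : PowerSeries.expand 5 (by norm_num) F = F ^ 5 := by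
  have h := MvPowerSeries.map_frobenius_expand (R := F5) 5 (by norm_num) (f := F)
  have hf : frobenius F5 5 = RingHom.id F5 := ZMod.frobenius_zmod 5
  rw [hf, MvPowerSeries.map_id] at h
  exact h

lemma main_formal (a : ℕ → ℤ)
    (ha : ∀ q : ℂ, ‖q‖ < 1 →
      ∑' n : ℕ, (a n : ℂ) * q ^ n = phiNeg (q ^ 5) ^ 5 / phiNeg q) :
    PowerSeries.mk a * TH ℤ = (PowerSeries.expand 5 (by norm_num) (TH ℤ)) ^ 5 := by
  have hinj : Function.Injective (PowerSeries.map (Int.castRingHom ℂ)) := by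
    intro F G h
    ext n
    have := congrArg (coeff n) h
    simpa using this
  apply hinj
  rw [map_mul, map_pow, map_expand, map_TH]
  apply EvAt.unique (v := fun q => phiNeg (q ^ 5) ^ 5)
  · intro q hq
    have hA : EvAt (PowerSeries.map (Int.castRingHom ℂ) (PowerSeries.mk a)) q
        (phiNeg (q ^ 5) ^ 5 / phiNeg q) := by
      have e : ∀ n, coeff n (PowerSeries.map (Int.castRingHom ℂ) (PowerSeries.mk a)) * q ^ n =
          (a n : ℂ) * q ^ n := by intro n; simp
      have hne : phiNeg (q ^ 5) ^ 5 / phiNeg q ≠ 0 :=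
        div_ne_zero (pow_ne_zero _ (phiNeg_ne (sq_norm_lt hq (by norm_num)))) (phiNeg_ne hq)
      constructor
      · simp only [e]
        apply Summable.norm
        by_contra hns
        apply hne
        rw [← ha q hq, tsum_eq_zero_of_not_summable hns]
      · simp only [e]
        exact ha q hq
    have := hA.mul (TH_ev hq)
    rwa [div_mul_cancel₀ _ (phiNeg_ne hq)] at this
  · intro q hq
    exact (TH_ev (sq_norm_lt hq (by norm_num))).expand.pow 5

lemma div_five (a : ℕ → ℤ)
    (h : PowerSeries.mk a * TH ℤ = (PowerSeries.expand 5 (by norm_num) (TH ℤ)) ^ 5) (n : ℕ)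
    (h4 : n % 4 = 2) (h5 : n % 5 = 1 ∨ n % 5 = 4) : (5 : ℤ) ∣ a n := by
  have h' := congrArg (PowerSeries.map (Int.castRingHom F5)) h
  rw [map_mul, map_pow, map_expand, map_TH, expand_F5, ← pow_mul] at h'
  have := cong5 _ h' n h4 h5
  rw [coeff_map, coeff_mk, eq_intCast] at this
  exact (ZMod.intCast_zmod_eq_zero_iff_dvd (a n) 5).1 this

lemma div_two (a : ℕ → ℤ)
    (h : PowerSeries.mk a * TH ℤ = (PowerSeries.expand 5 (by norm_num) (TH ℤ)) ^ 5) (n : ℕ)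
    (hn : n ≠ 0) : (2 : ℤ) ∣ a n := by
  have hone : TH (ZMod 2) = 1 := by
    ext m
    rw [coeff_one]
    split_ifs with hm
    · rw [hm, TH_zero]
    · by_cases hs : ∃ s : ℕ, s ^ 2 = m
      · obtain ⟨s, rfl⟩ := hs
        rw [TH_sq _ s (Nat.pos_of_ne_zero (by rintro rfl; simp at hm))]
        rw [show (2 : ZMod 2) = 0 from rfl, zero_mul]
      · exact TH_nonsq _ m hs
  have h' := congrArg (PowerSeries.map (Int.castRingHom (ZMod 2))) h
  rw [map_mul, map_pow, map_expand, map_TH, hone, map_one, one_pow, mul_one] at h'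
  have := congrArg (coeff n) h'
  rw [coeff_map, coeff_mk, eq_intCast, coeff_one, if_neg hn] at this
  exact (ZMod.intCast_zmod_eq_zero_iff_dvd (a n) 2).1 this

theorem stmt_8 (a : ℕ → ℤ)
    (ha : ∀ q : ℂ, ‖q‖ < 1 →
      ∑' n : ℕ, (a n : ℂ) * q ^ n = phiNeg (q ^ 5) ^ 5 / phiNeg q) :
    ∀ n : ℕ, (10 : ℤ) ∣ a (20 * n + 6) ∧ (10 : ℤ) ∣ a (20 * n + 14) := by
  intro n
  have h := main_formal a ha
  have h1 := div_five a h (20 * n + 6) (by omega) (by omega)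
  have h2 := div_two a h (20 * n + 6) (by omega)
  have h3 := div_five a h (20 * n + 14) (by omega) (by omega)
  have h4 := div_two a h (20 * n + 14) (by omega)
  omega
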